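/- Let d ≥ 1, 0 < γ < d, and r = 4d/(2d-γ), with r' the Hölder conjugate of r. There exists a constant C = C(d,γ) > 0 such that for every t ∈ ℝ and all Schwartz functions u₁,u₂,u₃ : ℝ^d → ℂ, ‖J(t)T(u₁,u₂,u₃)‖_{L^{r'}(ℝ^d)} ≤ C ∑_{i=1}^{3} ‖J(t)u_i‖_{L^r(ℝ^d)} ∏_{j≠i} ‖u_j‖_{L^r(ℝ^d)}. -/

import Mathlib

open MeasureTheory Complex
open scoped ENNReal NNReal

noncomputable section
/-- The trilinear Hartree form `T(u,v,w)(x) = (∫ |x-y|^{-γ} u(y) conj(v(y)) dy) · w(x)`,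
i.e. `T(u,v,w) = (|x|^{-γ} * (u v̄)) w`. -/
def hartreeT (d : ℕ) (γ : ℝ) (u v w : EuclideanSpace ℝ (Fin d) → ℂ)
    (x : EuclideanSpace ℝ (Fin d)) : ℂ :=
  (∫ y : EuclideanSpace ℝ (Fin d),
      ((‖x - y‖ ^ (-γ) : ℝ) : ℂ) * (u y * (starRingEnd ℂ) (v y))) * w x
/-- The Galilean vector field `J(t)u(x) = x u(x) + 2it ∇u(x)`, as a `ℂ^d`-valued function. -/
def Jfield (d : ℕ) (t : ℝ) (u : EuclideanSpace ℝ (Fin d) → ℂ)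
    (x : EuclideanSpace ℝ (Fin d)) : EuclideanSpace ℂ (Fin d) :=
  (WithLp.equiv 2 (Fin d → ℂ)).symm
    (fun j => (x j : ℂ) * u x +
      2 * Complex.I * (t : ℂ) * fderiv ℝ u x (EuclideanSpace.single j 1))


lemma hls_scale (d : ℕ) (h : EuclideanSpace ℝ (Fin d) → ℝ≥0∞) (hm : Measurable h) (R : ℝ) (hR : 0 < R) :
    ∫⁻ z, h z = ENNReal.ofReal (R ^ (d : ℝ)) * ∫⁻ z, h (R • z) := by
  have h1 := Measure.map_addHaar_smul (volume : Measure (EuclideanSpace ℝ (Fin d))) hR.ne'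
  have h2 : ∫⁻ z, h (R • z) = ∫⁻ z, h z ∂(Measure.map (R • ·) volume) :=
    (lintegral_map hm (measurable_const_smul R)).symm
  rw [h2, h1, lintegral_smul_measure, smul_eq_mul, ← mul_assoc, ← ENNReal.ofReal_mul (by positivity)]
  simp only [finrank_euclideanSpace, Fintype.card_fin, Real.rpow_natCast]
  rw [abs_of_pos (by positivity), mul_inv_cancel₀ (by positivity)]
  simp

lemma hls_near (d : ℕ) (hd : 1 ≤ d) (γ : ℝ) (hγd : γ < d) :
    ∃ C : ℝ≥0∞, C ≠ ∞ ∧ ∀ R : ℝ, 0 < R →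
      ∫⁻ z in Metric.ball (0 : EuclideanSpace ℝ (Fin d)) R, ENNReal.ofReal (‖z‖ ^ (-γ)) ≤
        C * ENNReal.ofReal (R ^ (d - γ)) := by
  have : Nonempty (Fin d) := ⟨⟨0, hd⟩⟩
  refine ⟨∫⁻ z in Metric.ball (0 : EuclideanSpace ℝ (Fin d)) 1, ENNReal.ofReal (‖z‖ ^ (-γ)), ?_, ?_⟩
  · have : IntegrableOn (fun z : EuclideanSpace ℝ (Fin d) => ‖z‖ ^ (-γ)) (Metric.ball 0 1) := by
      have := (integrableOn_fun_norm_addHaar (volume : Measure (EuclideanSpace ℝ (Fin d)))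
        (f := fun y : ℝ => y ^ (-γ)) (r := 1)).2 ?_
      · exact this
      · have h : IntegrableOn (fun y : ℝ => y ^ (d - 1 - γ)) (Set.Ioo 0 1) :=
          (intervalIntegral.integrableOn_Ioo_rpow_iff one_pos).2 (by linarith)
        refine h.congr_fun ?_ measurableSet_Ioo
        intro y hy
        simp only [finrank_euclideanSpace, Fintype.card_fin, smul_eq_mul]
        rw [← Real.rpow_natCast, ← Real.rpow_add hy.1]
        push_cast [hd]
        ring_nf
    exact this.lintegral_lt_top.ne
  · intro R hR
    rw [← lintegral_indicator measurableSet_ball, hls_scale d _ _ R hR, ← lintegral_indicator measurableSet_ball]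
    · have : ∀ z : EuclideanSpace ℝ (Fin d), (Metric.ball 0 R).indicator (fun z => ENNReal.ofReal (‖z‖ ^ (-γ))) (R • z)
        = ENNReal.ofReal (R ^ (-γ)) * (Metric.ball 0 1).indicator (fun z => ENNReal.ofReal (‖z‖ ^ (-γ))) z := by
        intro z
        have e : R • z ∈ Metric.ball (0 : EuclideanSpace ℝ (Fin d)) R ↔ z ∈ Metric.ball (0 : EuclideanSpace ℝ (Fin d)) 1 := by
          simp [norm_smul, abs_of_pos hR, hR]
        by_cases hz : z ∈ Metric.ball (0 : EuclideanSpace ℝ (Fin d)) 1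
        · rw [Set.indicator_of_mem hz, Set.indicator_of_mem (e.2 hz), ← ENNReal.ofReal_mul (by positivity),
            norm_smul, Real.norm_of_nonneg hR.le, Real.mul_rpow hR.le (norm_nonneg _)]
        · rw [Set.indicator_of_notMem hz, Set.indicator_of_notMem (fun h => hz (e.1 h)), mul_zero]
      simp_rw [this]
      rw [lintegral_const_mul, ← mul_assoc, ← ENNReal.ofReal_mul (by positivity), ← Real.rpow_add hR, mul_comm]
      · rfl
      · exact Measurable.indicator (by fun_prop) measurableSet_ball
    · exact Measurable.indicator (by fun_prop) measurableSet_ball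

lemma hls_far (d : ℕ) (hd : 1 ≤ d) (s : ℝ) (hs : d < s) :
    ∃ C : ℝ≥0∞, C ≠ ∞ ∧ ∀ R : ℝ, 0 < R →
      ∫⁻ z in (Metric.ball (0 : EuclideanSpace ℝ (Fin d)) R)ᶜ, ENNReal.ofReal (‖z‖ ^ (-s)) ≤
        C * ENNReal.ofReal (R ^ (d - s)) := by
  have : Nonempty (Fin d) := ⟨⟨0, hd⟩⟩
  refine ⟨∫⁻ z in (Metric.ball (0 : EuclideanSpace ℝ (Fin d)) 1)ᶜ, ENNReal.ofReal (‖z‖ ^ (-s)), ?_, ?_⟩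
  · have h := (integrable_one_add_norm (E := EuclideanSpace ℝ (Fin d)) (μ := volume) (r := s) (by simpa using hs)).const_mul (2 ^ s)
    have : IntegrableOn (fun z : EuclideanSpace ℝ (Fin d) => ‖z‖ ^ (-s)) (Metric.ball 0 1)ᶜ := by
      refine h.integrableOn.mono' (Measurable.aestronglyMeasurable (by fun_prop)) ?_
      filter_upwards [ae_restrict_mem measurableSet_ball.compl] with z hz
      have hz1 : 1 ≤ ‖z‖ := by simpa using hz
      rw [Real.norm_of_nonneg (by positivity), Real.rpow_neg (by positivity), Real.rpow_neg (by positivity), ← div_eq_mul_inv,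
        inv_eq_one_div, div_le_div_iff₀ (by positivity) (by positivity), one_mul, ← Real.mul_rpow (by norm_num) (by positivity)]
      have : (0 : ℝ) ≤ d := by positivity
      exact Real.rpow_le_rpow (by positivity) (by linarith) (by linarith)
    exact this.lintegral_lt_top.ne
  · intro R hR
    rw [← lintegral_indicator measurableSet_ball.compl, hls_scale d _ _ R hR, ← lintegral_indicator measurableSet_ball.compl]
    · have : ∀ z : EuclideanSpace ℝ (Fin d), (Metric.ball 0 R)ᶜ.indicator (fun z => ENNReal.ofReal (‖z‖ ^ (-s))) (R • z)
        = ENNReal.ofReal (R ^ (-s)) * (Metric.ball 0 1)ᶜ.indicator (fun z => ENNReal.ofReal (‖z‖ ^ (-s))) z := by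
        intro z
        have e : R • z ∈ (Metric.ball (0 : EuclideanSpace ℝ (Fin d)) R)ᶜ ↔ z ∈ (Metric.ball (0 : EuclideanSpace ℝ (Fin d)) 1)ᶜ := by
          simp [norm_smul, abs_of_pos hR, hR]
        by_cases hz : z ∈ (Metric.ball (0 : EuclideanSpace ℝ (Fin d)) 1)ᶜ
        · rw [Set.indicator_of_mem hz, Set.indicator_of_mem (e.2 hz), ← ENNReal.ofReal_mul (by positivity),
            norm_smul, Real.norm_of_nonneg hR.le, Real.mul_rpow hR.le (norm_nonneg _)]
        · rw [Set.indicator_of_notMem hz, Set.indicator_of_notMem (fun h => hz (e.1 h)), mul_zero]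
      simp_rw [this]
      rw [lintegral_const_mul, ← mul_assoc, ← ENNReal.ofReal_mul (by positivity), ← Real.rpow_add hR, mul_comm]
      · rfl
      · exact Measurable.indicator (by fun_prop) measurableSet_ball.compl
    · exact Measurable.indicator (by fun_prop) measurableSet_ball.compl

lemma hls_pot (d : ℕ) (hd : 1 ≤ d) (γ : ℝ) (hγ0 : 0 < γ) (hγd : γ < d) (p : ℝ) (hp : p = 2 * d / (2 * d - γ)) :
    ∃ C : ℝ≥0∞, C ≠ ∞ ∧ C ≠ 0 ∧ ∀ g : EuclideanSpace ℝ (Fin d) → ℝ≥0∞, Measurable g →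
      ∫⁻ y, g y ^ p ≤ 1 → ∀ (x : EuclideanSpace ℝ (Fin d)) (a : ℝ≥0∞),
      ∫⁻ y, {y | g y ≤ a}.indicator (fun y => ENNReal.ofReal (‖x - y‖ ^ (-γ)) * g y) y ≤ C * a ^ (p - 1) := by
  have hd0 : (0 : ℝ) < d := by exact_mod_cast hd
  have hp1 : 1 < p := by rw [hp, lt_div_iff₀ (by linarith)]; linarith
  obtain ⟨C1, hC1, h1⟩ := hls_near d hd γ hγd
  obtain ⟨C2, hC2, h2⟩ := hls_far d hd (2 * d) (by linarith)
  set q : ℝ := 2 * d / γ with hq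
  have hq0 : 0 < q := by positivity
  have hpq : q.HolderConjugate p := by
    rw [Real.holderConjugate_comm, Real.holderConjugate_iff]
    refine ⟨hp1, ?_⟩
    rw [hp, hq]; field_simp; ring
  refine ⟨C1 + C2 ^ (1 / q) + 1, ?_, by simp, ?_⟩
  · simp [hC1, hC2, hq0.le]
  intro g hg hg1 x a
  rcases eq_or_ne a 0 with rfl | ha0
  · have : ∀ y, {y | g y ≤ 0}.indicator (fun y => ENNReal.ofReal (‖x - y‖ ^ (-γ)) * g y) y = 0 := by
      intro y
      by_cases hy : g y ≤ 0
      · rw [Set.indicator_of_mem (by exact hy), nonpos_iff_eq_zero.1 hy, mul_zero]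
      · exact Set.indicator_of_notMem (by exact hy) _
    simp_rw [this]
    rw [lintegral_zero]; exact zero_le
  rcases eq_or_ne a ∞ with rfl | hat
  · rw [ENNReal.top_rpow_of_pos (by linarith), ENNReal.mul_top (by simp)]
    exact le_top
  obtain ⟨b, hb, rfl⟩ : ∃ b : ℝ, 0 < b ∧ a = ENNReal.ofReal b :=
    ⟨a.toReal, ENNReal.toReal_pos ha0 hat, (ENNReal.ofReal_toReal hat).symm⟩
  set R : ℝ := b ^ (-p / d) with hR
  have hR0 : 0 < R := by positivity
  set B := Metric.ball (0 : EuclideanSpace ℝ (Fin d)) R with hB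
  have hmB : MeasurableSet B := measurableSet_ball
  set K : EuclideanSpace ℝ (Fin d) → ℝ≥0∞ := fun z => ENNReal.ofReal (‖z‖ ^ (-γ)) with hK
  have hKm : Measurable K := by fun_prop
  have hKB : Measurable (B.indicator K) := hKm.indicator hmB
  have hKBc : Measurable (Bᶜ.indicator K) := hKm.indicator hmB.compl
  have e1 : ∫⁻ y, B.indicator K (x - y) = ∫⁻ z in B, K z := by
    rw [lintegral_sub_left_eq_self (B.indicator K) x, lintegral_indicator hmB]
  have e2 : ∫⁻ y, (Bᶜ.indicator K (x - y)) ^ q ≤ C2 * ENNReal.ofReal (R ^ ((d : ℝ) - 2 * d)) := by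
    rw [lintegral_sub_left_eq_self (fun z => (Bᶜ.indicator K z) ^ q) x]
    refine le_trans (le_of_eq ?_) (h2 R hR0)
    rw [← lintegral_indicator hmB.compl]
    congr 1; ext z
    by_cases hz : z ∈ Bᶜ
    · rw [Set.indicator_of_mem hz, Set.indicator_of_mem hz, ENNReal.ofReal_rpow_of_nonneg (by positivity) hq0.le,
        ← Real.rpow_mul (norm_nonneg _)]
      congr 2; rw [hq]; field_simp
    · rw [Set.indicator_of_notMem hz, Set.indicator_of_notMem hz, ENNReal.zero_rpow_of_pos hq0]
  have hpt : ∀ y, {y | g y ≤ ENNReal.ofReal b}.indicator (fun y => K (x - y) * g y) y ≤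
      B.indicator K (x - y) * ENNReal.ofReal b + Bᶜ.indicator K (x - y) * g y := by
    intro y
    by_cases hy : g y ≤ ENNReal.ofReal b
    · rw [Set.indicator_of_mem (by exact hy)]
      by_cases hz : x - y ∈ B
      · rw [Set.indicator_of_mem hz]
        exact le_add_right (by gcongr)
      · rw [Set.indicator_of_mem (s := Bᶜ) (by exact hz)]
        exact le_add_left le_rfl
    · rw [Set.indicator_of_notMem (by exact hy)]; exact zero_le
  refine (lintegral_mono hpt).trans ?_
  rw [lintegral_add_left (by fun_prop), lintegral_mul_const _ (by fun_prop), e1]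
  have i1 : (∫⁻ z in B, K z) * ENNReal.ofReal b ≤ C1 * ENNReal.ofReal b ^ (p - 1) := by
    refine (mul_le_mul_left (h1 R hR0) _).trans (le_of_eq ?_)
    rw [mul_assoc, ← ENNReal.ofReal_mul (by positivity), ENNReal.ofReal_rpow_of_pos hb]
    congr 2
    rw [hR, ← Real.rpow_mul hb.le, ← Real.rpow_add_one hb.ne']
    congr 1
    rw [hp]; field_simp [show (2 * (d : ℝ) - γ) ≠ 0 by linarith]; ring
  have i2 : ∫⁻ y, Bᶜ.indicator K (x - y) * g y ≤ C2 ^ (1 / q) * ENNReal.ofReal b ^ (p - 1) := by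
    refine (ENNReal.lintegral_mul_le_Lp_mul_Lq volume hpq (f := fun y => Bᶜ.indicator K (x - y)) (g := g)
      (by fun_prop) hg.aemeasurable).trans ?_
    have j1 : (∫⁻ y, g y ^ p) ^ (1 / p) ≤ 1 := ENNReal.rpow_le_one hg1 (by positivity)
    refine (mul_le_mul' (ENNReal.rpow_le_rpow e2 (by positivity)) j1).trans (le_of_eq ?_)
    rw [mul_one, ENNReal.mul_rpow_of_nonneg _ _ (by positivity), ENNReal.ofReal_rpow_of_pos hb,
      ENNReal.ofReal_rpow_of_pos (by positivity)]
    congr 2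
    rw [hR, ← Real.rpow_mul hb.le, ← Real.rpow_mul hb.le]
    congr 1
    rw [hp, hq]; field_simp [show (2 * (d : ℝ) - γ) ≠ 0 by linarith]; ring
  refine (add_le_add i1 i2).trans ?_
  rw [← add_mul]
  exact mul_le_mul_left le_self_add _

lemma hls_bil (d : ℕ) (hd : 1 ≤ d) (γ : ℝ) (hγ0 : 0 < γ) (hγd : γ < d) (p : ℝ) (hp : p = 2 * d / (2 * d - γ)) :
    ∃ C : ℝ≥0∞, C ≠ ∞ ∧ C ≠ 0 ∧ ∀ f g : EuclideanSpace ℝ (Fin d) → ℝ≥0∞, Measurable f → Measurable g →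
      ∫⁻ y, f y ^ p ≤ 1 → ∫⁻ y, g y ^ p ≤ 1 →
      ∫⁻ x, f x * ∫⁻ y, ENNReal.ofReal (‖x - y‖ ^ (-γ)) * g y ≤ C := by
  obtain ⟨C, hC, hC0, h⟩ := hls_pot d hd γ hγ0 hγd p hp
  have hd0 : (0 : ℝ) < d := by exact_mod_cast hd
  have hp1 : 1 < p := by rw [hp, lt_div_iff₀ (by linarith)]; linarith
  refine ⟨C + C, by simp [hC], by simp [hC0], ?_⟩
  intro f g hf hg hf1 hg1
  set K : EuclideanSpace ℝ (Fin d) → ℝ≥0∞ := fun z => ENNReal.ofReal (‖z‖ ^ (-γ)) with hK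
  have hKm : Measurable K := by fun_prop
  have key : ∀ f g : EuclideanSpace ℝ (Fin d) → ℝ≥0∞, Measurable f → Measurable g →
      ∫⁻ y, f y ^ p ≤ 1 → ∫⁻ y, g y ^ p ≤ 1 →
      ∫⁻ x, f x * ∫⁻ y, {y | g y ≤ f x}.indicator (fun y => K (x - y) * g y) y ≤ C := by
    intro f g hf hg hf1 hg1
    calc _ ≤ ∫⁻ x, C * f x ^ p := by
          refine lintegral_mono fun x => ?_
          refine (mul_le_mul_right (h g hg hg1 x (f x)) _).trans (le_of_eq ?_)
          rw [mul_left_comm]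
          congr 1
          nth_rw 1 [← ENNReal.rpow_one (f x)]
          rw [← ENNReal.rpow_add_of_nonneg _ _ (by norm_num) (by linarith)]
          congr 1; ring
      _ = C * ∫⁻ x, f x ^ p := lintegral_const_mul _ (by fun_prop)
      _ ≤ C * 1 := by gcongr
      _ = C := mul_one C
  have meas : ∀ f g : EuclideanSpace ℝ (Fin d) → ℝ≥0∞, Measurable f → Measurable g →
      Measurable (fun z : EuclideanSpace ℝ (Fin d) × EuclideanSpace ℝ (Fin d) =>
        {y | g y ≤ f z.1}.indicator (fun y => K (z.1 - y) * g y) z.2) := by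
    intro f g hf hg
    have : Measurable ({z : EuclideanSpace ℝ (Fin d) × EuclideanSpace ℝ (Fin d) | g z.2 ≤ f z.1}.indicator
        (fun z => K (z.1 - z.2) * g z.2)) :=
      Measurable.indicator (by fun_prop) (measurableSet_le (by fun_prop) (by fun_prop))
    exact this
  have pt : ∀ x y, f x * (K (x - y) * g y) ≤ f x * {y | g y ≤ f x}.indicator (fun y => K (x - y) * g y) y +
      g y * {x | f x ≤ g y}.indicator (fun x => K (y - x) * f x) x := by
    intro x y
    rcases le_total (g y) (f x) with hxy | hxy
    · rw [Set.indicator_of_mem (by exact hxy)]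
      exact le_self_add
    · rw [Set.indicator_of_mem (s := {x | f x ≤ g y}) (by exact hxy)]
      refine le_add_left (le_of_eq ?_)
      have : K (y - x) = K (x - y) := by simp only [hK, norm_sub_rev]
      rw [this]; ring
  calc ∫⁻ x, f x * ∫⁻ y, K (x - y) * g y
      = ∫⁻ x, ∫⁻ y, f x * (K (x - y) * g y) := by
        congr 1; ext x; rw [lintegral_const_mul _ (by fun_prop)]
    _ ≤ ∫⁻ x, ∫⁻ y, (f x * {y | g y ≤ f x}.indicator (fun y => K (x - y) * g y) y +
      g y * {x | f x ≤ g y}.indicator (fun x => K (y - x) * f x) x) :=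
        lintegral_mono fun x => lintegral_mono fun y => pt x y
    _ = (∫⁻ x, f x * ∫⁻ y, {y | g y ≤ f x}.indicator (fun y => K (x - y) * g y) y) +
         ∫⁻ x, ∫⁻ y, g y * {x | f x ≤ g y}.indicator (fun x => K (y - x) * f x) x := by
        rw [← lintegral_add_left]
        · congr 1; ext x
          have m : Measurable fun y => {y | g y ≤ f x}.indicator (fun y => K (x - y) * g y) y :=
            (meas f g hf hg).comp (measurable_const.prodMk measurable_id)
          rw [lintegral_add_left (m.const_mul _), lintegral_const_mul _ m]
        · exact hf.mul (meas f g hf hg).lintegral_prod_right'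
    _ = (∫⁻ x, f x * ∫⁻ y, {y | g y ≤ f x}.indicator (fun y => K (x - y) * g y) y) +
         ∫⁻ y, g y * ∫⁻ x, {x | f x ≤ g y}.indicator (fun x => K (y - x) * f x) x := by
        congr 1
        rw [lintegral_lintegral_swap]
        · congr 1; ext y
          have m : Measurable fun x => {x | f x ≤ g y}.indicator (fun x => K (y - x) * f x) x :=
            (meas g f hg hf).comp (measurable_const.prodMk measurable_id)
          rw [lintegral_const_mul _ m]
        · have := (hg.comp measurable_fst).mul (meas g f hg hf)
          exact (this.comp measurable_swap).aemeasurable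
    _ ≤ C + C := add_le_add (key f g hf hg hf1 hg1) (key g f hg hf hg1 hf1)

lemma hls_bil' (d : ℕ) (hd : 1 ≤ d) (γ : ℝ) (hγ0 : 0 < γ) (hγd : γ < d) (p : ℝ) (hp : p = 2 * d / (2 * d - γ)) :
    ∃ C : ℝ≥0∞, C ≠ ∞ ∧ C ≠ 0 ∧ ∀ f g : EuclideanSpace ℝ (Fin d) → ℝ≥0∞, Measurable f → Measurable g →
      ∫⁻ x, f x * ∫⁻ y, ENNReal.ofReal (‖x - y‖ ^ (-γ)) * g y ≤
        C * ((∫⁻ y, f y ^ p) ^ (1 / p) * (∫⁻ y, g y ^ p) ^ (1 / p)) := by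
  obtain ⟨C, hC, hC0, h⟩ := hls_bil d hd γ hγ0 hγd p hp
  have hd0 : (0 : ℝ) < d := by exact_mod_cast hd
  have hp1 : 1 < p := by rw [hp, lt_div_iff₀ (by linarith)]; linarith
  have hp0 : 0 < p := by linarith
  refine ⟨C, hC, hC0, ?_⟩
  intro f g hf hg
  set A := ∫⁻ y, f y ^ p with hA
  set B := ∫⁻ y, g y ^ p with hB
  have z : ∀ f : EuclideanSpace ℝ (Fin d) → ℝ≥0∞, Measurable f → ∫⁻ y, f y ^ p = 0 → ∀ᵐ y, f y = 0 := by
    intro f hf h0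
    rw [lintegral_eq_zero_iff (by fun_prop)] at h0
    filter_upwards [h0] with y hy
    simpa [hp0, hp0.le, hp0.not_gt] using hy
  by_cases hA0 : A = 0
  · have : ∫⁻ x, f x * ∫⁻ y, ENNReal.ofReal (‖x - y‖ ^ (-γ)) * g y = 0 := by
      rw [← lintegral_zero (μ := (volume : Measure (EuclideanSpace ℝ (Fin d))))]
      apply lintegral_congr_ae
      filter_upwards [z f hf hA0] with x hx
      simp [hx]
    rw [this]; exact zero_le
  by_cases hB0 : B = 0
  · have : ∀ x, ∫⁻ y, ENNReal.ofReal (‖x - y‖ ^ (-γ)) * g y = 0 := by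
      intro x
      rw [← lintegral_zero (μ := (volume : Measure (EuclideanSpace ℝ (Fin d))))]
      apply lintegral_congr_ae
      filter_upwards [z g hg hB0] with x hx
      simp [hx]
    simp [this]
  by_cases hAt : A = ∞
  · rw [hAt, ENNReal.top_rpow_of_pos (by positivity), ENNReal.top_mul, ENNReal.mul_top hC0]
    · exact le_top
    · simp [hB0, hp0.le]
  by_cases hBt : B = ∞
  · rw [hBt, ENNReal.top_rpow_of_pos (by positivity), ENNReal.mul_top, ENNReal.mul_top hC0]
    · exact le_top
    · simp [hA0, hp0.le]
  have nrm : ∀ (f : EuclideanSpace ℝ (Fin d) → ℝ≥0∞), Measurable f → ∫⁻ y, f y ^ p ≠ 0 → ∫⁻ y, f y ^ p ≠ ∞ →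
      ∫⁻ y, (((∫⁻ y, f y ^ p) ^ (1 / p))⁻¹ * f y) ^ p ≤ 1 := by
    intro f hf h0 ht
    simp_rw [ENNReal.mul_rpow_of_nonneg _ _ hp0.le]
    rw [lintegral_const_mul _ (by fun_prop), ENNReal.inv_rpow, ← ENNReal.rpow_mul, one_div_mul_cancel hp0.ne',
      ENNReal.rpow_one, ENNReal.inv_mul_cancel h0 ht]
  have := h (fun x => (A ^ (1 / p))⁻¹ * f x) (fun x => (B ^ (1 / p))⁻¹ * g x) (by fun_prop) (by fun_prop)
    (nrm f hf hA0 hAt) (nrm g hg hB0 hBt)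
  have e : ∫⁻ x, (A ^ (1 / p))⁻¹ * f x * ∫⁻ y, ENNReal.ofReal (‖x - y‖ ^ (-γ)) * ((B ^ (1 / p))⁻¹ * g y) =
      (A ^ (1 / p) * B ^ (1 / p))⁻¹ * ∫⁻ x, f x * ∫⁻ y, ENNReal.ofReal (‖x - y‖ ^ (-γ)) * g y := by
    rw [← lintegral_const_mul]
    · congr 1; ext x
      simp_rw [mul_left_comm _ (B ^ (1 / p))⁻¹]
      rw [lintegral_const_mul _ (by fun_prop), ENNReal.mul_inv (by simp [hp0.le, hBt]) (by simp [hp0.le, hAt])]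
      ring
    · refine hf.mul (Measurable.lintegral_prod_right' (f := fun z : _ × _ => ENNReal.ofReal (‖z.1 - z.2‖ ^ (-γ)) * g z.2) ?_)
      fun_prop
  rw [e] at this
  rw [mul_comm]
  rwa [ENNReal.inv_mul_le_iff] at this
  · simp [hp0.le, hp0, hA0, hB0, hAt, hBt]
  · exact ENNReal.mul_ne_top (by simp [hp0.le, hAt]) (by simp [hp0.le, hBt])

lemma hls_op (d : ℕ) (hd : 1 ≤ d) (γ : ℝ) (hγ0 : 0 < γ) (hγd : γ < d) (p q : ℝ) (hp : p = 2 * d / (2 * d - γ))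
    (hq : q = 2 * d / γ) :
    ∃ C : ℝ≥0∞, C ≠ ∞ ∧ C ≠ 0 ∧ ∀ g : EuclideanSpace ℝ (Fin d) → ℝ≥0∞, Measurable g →
      (∫⁻ x, (∫⁻ y, ENNReal.ofReal (‖x - y‖ ^ (-γ)) * g y) ^ q) ^ (1 / q) ≤
        C * (∫⁻ y, g y ^ p) ^ (1 / p) := by
  obtain ⟨C, hC, hC0, h⟩ := hls_bil' d hd γ hγ0 hγd p hp
  have hd0 : (0 : ℝ) < d := by exact_mod_cast hd
  have hp1 : 1 < p := by rw [hp, lt_div_iff₀ (by linarith)]; linarith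
  have hp0 : 0 < p := by linarith
  have hq1 : 1 < q := by rw [hq, lt_div_iff₀ (by linarith)]; linarith
  have hq0 : 0 < q := by linarith
  have hpq : 1 / p + 1 / q = 1 := by
    rw [hp, hq]; field_simp; ring
  have hpq2 : (q - 1) * p = q := by
    rw [hp, hq]; field_simp [show (2 * (d : ℝ) - γ) ≠ 0 by linarith]
  refine ⟨C, hC, hC0, ?_⟩
  intro g hg
  set G : EuclideanSpace ℝ (Fin d) → ℝ≥0∞ := fun x => ∫⁻ y, ENNReal.ofReal (‖x - y‖ ^ (-γ)) * g y with hG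
  have hGm : Measurable G := by
    refine Measurable.lintegral_prod_right' (f := fun z : _ × _ => ENNReal.ofReal (‖z.1 - z.2‖ ^ (-γ)) * g z.2) ?_
    fun_prop
  set M := C * (∫⁻ y, g y ^ p) ^ (1 / p) with hM
  let H : ℕ → EuclideanSpace ℝ (Fin d) → ℝ≥0∞ := fun n => (Metric.ball 0 (n : ℝ)).indicator (fun x => min (G x) n)
  have hHm : ∀ n, Measurable (H n) := fun n => Measurable.indicator (by fun_prop) measurableSet_ball
  have hHG : ∀ n x, H n x ≤ G x := by
    intro n x
    by_cases hx : x ∈ Metric.ball (0 : EuclideanSpace ℝ (Fin d)) (n : ℝ)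
    · simp only [H, Set.indicator_of_mem hx]; exact min_le_left _ _
    · simp only [H, Set.indicator_of_notMem hx]; exact zero_le
  have hHle : ∀ n, ∫⁻ x, H n x ^ q ≤ M ^ q := by
    intro n
    set A := ∫⁻ x, H n x ^ q with hA
    have hAt : A ≠ ∞ := by
      have : A ≤ ∫⁻ x, (Metric.ball (0 : EuclideanSpace ℝ (Fin d)) (n : ℝ)).indicator (fun _ => (n : ℝ≥0∞) ^ q) x := by
        refine lintegral_mono fun x => ?_
        by_cases hx : x ∈ Metric.ball (0 : EuclideanSpace ℝ (Fin d)) (n : ℝ)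
        · simp only [H, Set.indicator_of_mem hx]
          exact ENNReal.rpow_le_rpow (min_le_right _ _) hq0.le
        · simp only [H, Set.indicator_of_notMem hx, ENNReal.zero_rpow_of_pos hq0, le_refl]
      refine ne_top_of_le_ne_top ?_ this
      rw [lintegral_indicator_const measurableSet_ball]
      refine ENNReal.mul_ne_top ?_ measure_ball_lt_top.ne
      exact ENNReal.rpow_ne_top_of_nonneg hq0.le (by simp)
    by_cases hA0 : A = 0
    · rw [hA0]; exact zero_le
    have b := h (fun x => H n x ^ (q - 1)) g (by fun_prop) hg
    have e1 : ∫⁻ y, (H n y ^ (q - 1)) ^ p = A := by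
      simp_rw [← ENNReal.rpow_mul, hpq2]; rfl
    have e2 : A ≤ ∫⁻ x, H n x ^ (q - 1) * G x := by
      refine lintegral_mono fun x => ?_
      refine le_trans (le_of_eq ?_) (mul_le_mul_right (hHG n x) _)
      nth_rw 3 [← ENNReal.rpow_one (H n x)]
      rw [← ENNReal.rpow_add_of_nonneg _ _ (by linarith) (by norm_num)]
      congr 1; ring
    rw [e1] at b
    have b2 := e2.trans b
    have b3 : A ^ (1 / p) * A ^ (1 / q) ≤ A ^ (1 / p) * M := by
      rw [← ENNReal.rpow_add _ _ hA0 hAt, hpq, ENNReal.rpow_one]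
      refine b2.trans (le_of_eq ?_)
      rw [hM]; ring
    have b4 : A ^ (1 / q) ≤ M := by
      rwa [ENNReal.mul_le_mul_iff_right] at b3
      · simp [hA0, hAt]
      · simp [hp0.le, hAt]
    have := ENNReal.rpow_le_rpow b4 hq0.le
    rwa [← ENNReal.rpow_mul, one_div_mul_cancel hq0.ne', ENNReal.rpow_one] at this
  have lim : ∫⁻ x, G x ^ q ≤ M ^ q := by
    have hmono : ∀ x, Monotone fun n => H n x ^ q := by
      intro x m n hmn
      refine ENNReal.rpow_le_rpow ?_ hq0.le
      have hmn' : (m : ℝ) ≤ n := by exact_mod_cast hmn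
      by_cases hx : x ∈ Metric.ball (0 : EuclideanSpace ℝ (Fin d)) (m : ℝ)
      · have hx' := Metric.ball_subset_ball hmn' hx
        simp only [H, Set.indicator_of_mem hx, Set.indicator_of_mem hx']
        gcongr
      · simp only [H, Set.indicator_of_notMem hx]; exact zero_le
    have t := lintegral_tendsto_of_tendsto_of_monotone (μ := volume) (f := fun n x => H n x ^ q) (F := fun x => G x ^ q)
      (fun n => ((hHm n).pow_const q).aemeasurable) (Filter.Eventually.of_forall hmono) (Filter.Eventually.of_forall ?_)
    · exact le_of_tendsto' t hHle
    · intro x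
      refine (ENNReal.continuous_rpow_const.tendsto _).comp ?_
      have t1 : Filter.Tendsto (fun n : ℕ => min (G x) (n : ℝ≥0∞)) Filter.atTop (nhds (G x)) := by
        simpa using (tendsto_const_nhds (x := G x)).min ENNReal.tendsto_nat_nhds_top
      refine t1.congr' ?_
      filter_upwards [Filter.eventually_gt_atTop ⌈‖x‖⌉₊] with n hn
      have hx : x ∈ Metric.ball (0 : EuclideanSpace ℝ (Fin d)) (n : ℝ) := by
        simpa using Nat.lt_of_ceil_lt hn
      simp only [H, Set.indicator_of_mem hx]
  have := ENNReal.rpow_le_rpow lim (show 0 ≤ 1 / q by positivity)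
  rwa [← ENNReal.rpow_mul, mul_one_div_cancel hq0.ne', ENNReal.rpow_one] at this

lemma hls_tri (d : ℕ) (hd : 1 ≤ d) (γ : ℝ) (hγ0 : 0 < γ) (hγd : γ < d) (r r' : ℝ) (hr : r = 4 * d / (2 * d - γ))
    (hr' : r' = 4 * d / (2 * d + γ)) :
    ∃ C : ℝ≥0∞, C ≠ ∞ ∧ C ≠ 0 ∧ ∀ a b c : EuclideanSpace ℝ (Fin d) → ℝ≥0∞,
      Measurable a → Measurable b → Measurable c →
      (∫⁻ x, ((∫⁻ y, ENNReal.ofReal (‖x - y‖ ^ (-γ)) * (a y * b y)) * c x) ^ r') ^ (1 / r') ≤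
        C * ((∫⁻ y, a y ^ r) ^ (1 / r) * (∫⁻ y, b y ^ r) ^ (1 / r) * (∫⁻ y, c y ^ r) ^ (1 / r)) := by
  have hd0 : (0 : ℝ) < d := by exact_mod_cast hd
  obtain ⟨C, hC, hC0, h⟩ := hls_op d hd γ hγ0 hγd _ _ rfl rfl
  refine ⟨C, hC, hC0, ?_⟩
  intro a b c ha hb hc
  have h2 : (0 : ℝ) < 2 * d - γ := by linarith
  set p : ℝ := 2 * d / (2 * d - γ) with hp
  set q : ℝ := 2 * d / γ with hq
  have hGm : Measurable fun x => ∫⁻ y, ENNReal.ofReal (‖x - y‖ ^ (-γ)) * (a y * b y) := by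
    refine Measurable.lintegral_prod_right' (f := fun z : EuclideanSpace ℝ (Fin d) × EuclideanSpace ℝ (Fin d) =>
      ENNReal.ofReal (‖z.1 - z.2‖ ^ (-γ)) * (a z.2 * b z.2)) ?_
    fun_prop
  have i1 := ENNReal.lintegral_Lp_mul_le_Lq_mul_Lr (p := r') (q := q) (r := r) (by rw [hr']; positivity)
    (by rw [hr', hq, div_lt_div_iff₀ (by linarith) hγ0]; nlinarith)
    (by rw [hr', hq, hr]; field_simp; ring) volume hGm.aemeasurable hc.aemeasurable
  have i2 := h (fun y => a y * b y) (by fun_prop)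
  have i3 := ENNReal.lintegral_Lp_mul_le_Lq_mul_Lr (p := p) (q := r) (r := r) (by positivity)
    (by rw [hr, hp]; gcongr; linarith)
    (by rw [hp, hr]; field_simp; ring) volume ha.aemeasurable hb.aemeasurable
  refine i1.trans ?_
  rw [← mul_assoc]
  refine mul_le_mul_left (i2.trans (mul_le_mul_right i3 C)) _

lemma hls_ker_integrable (d : ℕ) (hd : 1 ≤ d) (γ : ℝ) (hγ0 : 0 < γ) (hγd : γ < d) :
    Integrable (fun z : EuclideanSpace ℝ (Fin d) => ‖z‖ ^ (-γ) * (1 + ‖z‖) ^ (-((d + 1 : ℕ) : ℝ))) := by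
  obtain ⟨C, hC, h⟩ := hls_near d hd γ hγd
  have m : Measurable (fun z : EuclideanSpace ℝ (Fin d) => ‖z‖ ^ (-γ)) := by fun_prop
  have m2 : Measurable (fun z : EuclideanSpace ℝ (Fin d) => ‖z‖ ^ (-γ) * (1 + ‖z‖) ^ (-((d + 1 : ℕ) : ℝ))) := by fun_prop
  have i1 : IntegrableOn (fun z : EuclideanSpace ℝ (Fin d) => ‖z‖ ^ (-γ)) (Metric.ball 0 1) := by
    refine (lintegral_ofReal_ne_top_iff_integrable m.aestronglyMeasurable
      (Filter.Eventually.of_forall fun z => by positivity)).1 ?_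
    refine ne_top_of_le_ne_top ?_ (h 1 one_pos)
    exact ENNReal.mul_ne_top hC ENNReal.ofReal_ne_top
  have i2 := (integrable_one_add_norm (E := EuclideanSpace ℝ (Fin d)) (μ := volume) (r := ((d + 1 : ℕ) : ℝ)) (by simp))
  rw [← integrableOn_univ, ← Set.union_compl_self (Metric.ball (0 : EuclideanSpace ℝ (Fin d)) 1)]
  refine IntegrableOn.union ?_ ?_
  · refine Integrable.mono' i1 m2.aestronglyMeasurable (Filter.Eventually.of_forall fun z => ?_)
    rw [Real.norm_of_nonneg (by positivity)]
    refine mul_le_of_le_one_right (by positivity) ?_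
    exact Real.rpow_le_one_of_one_le_of_nonpos (by simp) (neg_nonpos.2 (Nat.cast_nonneg _))
  · refine Integrable.mono' i2.integrableOn m2.aestronglyMeasurable ?_
    filter_upwards [ae_restrict_mem measurableSet_ball.compl] with z hz
    have hz1 : 1 ≤ ‖z‖ := by simpa using hz
    rw [Real.norm_of_nonneg (by positivity)]
    refine mul_le_of_le_one_left (by positivity) ?_
    exact Real.rpow_le_one_of_one_le_of_nonpos hz1 (by linarith)

lemma schwartz_unif {d : ℕ} {V : Type*} [NormedAddCommGroup V] [NormedSpace ℝ V]
    (f : SchwartzMap (EuclideanSpace ℝ (Fin d)) V) (x₀ : EuclideanSpace ℝ (Fin d)) :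
    ∃ M : ℝ, ∀ x ∈ Metric.ball x₀ 1, ∀ z, ‖f (x - z)‖ ≤ M * (1 + ‖z‖) ^ (-((d + 1 : ℕ) : ℝ)) := by
  obtain ⟨A, hA⟩ : ∃ A : ℝ, ∀ y, (1 + ‖y‖) ^ (d + 1) * ‖f y‖ ≤ A :=
    ⟨_, fun y => by
      simpa using SchwartzMap.one_add_le_sup_seminorm_apply (𝕜 := ℝ) (m := (d + 1, 0)) le_rfl le_rfl f y⟩
  refine ⟨(2 + ‖x₀‖) ^ (d + 1) * A, fun x hx z => ?_⟩
  rw [Real.rpow_neg (by positivity), Real.rpow_natCast, ← div_eq_mul_inv, le_div_iff₀ (by positivity)]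
  have hx1 : ‖x‖ ≤ 1 + ‖x₀‖ := by
    have := norm_le_norm_add_norm_sub' x x₀
    have h2 : ‖x - x₀‖ < 1 := by simpa [dist_eq_norm] using hx
    linarith
  have h1 : 1 + ‖z‖ ≤ (2 + ‖x₀‖) * (1 + ‖x - z‖) := by
    have : ‖z‖ ≤ ‖x‖ + ‖x - z‖ := by
      have := norm_sub_le x (x - z); simpa using this
    nlinarith [norm_nonneg x₀, norm_nonneg (x - z)]
  calc ‖f (x - z)‖ * (1 + ‖z‖) ^ (d + 1) ≤ ‖f (x - z)‖ * ((2 + ‖x₀‖) * (1 + ‖x - z‖)) ^ (d + 1) := by gcongr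
    _ = (2 + ‖x₀‖) ^ (d + 1) * ((1 + ‖x - z‖) ^ (d + 1) * ‖f (x - z)‖) := by rw [mul_pow]; ring
    _ ≤ _ := by gcongr; exact hA _

lemma schwartz_ker_bound {d : ℕ} (hd : 1 ≤ d) {γ : ℝ} (hγ0 : 0 < γ) (hγd : γ < d)
    {V : Type*} [NormedAddCommGroup V] [NormedSpace ℝ V]
    (f : SchwartzMap (EuclideanSpace ℝ (Fin d)) V) (x₀ : EuclideanSpace ℝ (Fin d)) :
    ∃ b : EuclideanSpace ℝ (Fin d) → ℝ, Integrable b ∧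
      ∀ x ∈ Metric.ball x₀ 1, ∀ z, ‖(‖z‖ ^ (-γ)) • f (x - z)‖ ≤ b z := by
  obtain ⟨M, hM⟩ := schwartz_unif f x₀
  refine ⟨_, (hls_ker_integrable d hd γ hγ0 hγd).const_mul M, fun x hx z => ?_⟩
  rw [norm_smul, Real.norm_of_nonneg (by positivity), mul_left_comm]
  exact mul_le_mul_of_nonneg_left (hM x hx z) (by positivity)

lemma schwartz_ker_meas {d : ℕ} {γ : ℝ}
    {V : Type*} [NormedAddCommGroup V] [NormedSpace ℝ V]
    (f : SchwartzMap (EuclideanSpace ℝ (Fin d)) V) (x : EuclideanSpace ℝ (Fin d)) :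
    AEStronglyMeasurable (fun z : EuclideanSpace ℝ (Fin d) => (‖z‖ ^ (-γ)) • f (x - z)) := by
  refine AEStronglyMeasurable.smul (Measurable.aestronglyMeasurable (by fun_prop)) ?_
  exact (f.continuous.comp (continuous_const.sub continuous_id)).aestronglyMeasurable

lemma schwartz_ker_int {d : ℕ} (hd : 1 ≤ d) {γ : ℝ} (hγ0 : 0 < γ) (hγd : γ < d)
    {V : Type*} [NormedAddCommGroup V] [NormedSpace ℝ V]
    (f : SchwartzMap (EuclideanSpace ℝ (Fin d)) V) (x : EuclideanSpace ℝ (Fin d)) :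
    Integrable (fun z : EuclideanSpace ℝ (Fin d) => (‖z‖ ^ (-γ)) • f (x - z)) := by
  obtain ⟨b, hb, h⟩ := schwartz_ker_bound hd hγ0 hγd f x
  exact hb.mono' (schwartz_ker_meas f x) (Filter.Eventually.of_forall (h x (Metric.mem_ball_self one_pos)))

lemma conv_deriv {d : ℕ} (hd : 1 ≤ d) {γ : ℝ} (hγ0 : 0 < γ) (hγd : γ < d)
    (F : SchwartzMap (EuclideanSpace ℝ (Fin d)) ℂ) (x : EuclideanSpace ℝ (Fin d)) :
    ∃ L : EuclideanSpace ℝ (Fin d) →L[ℝ] ℂ,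
      HasFDerivAt (fun x => ∫ y, ((‖x - y‖ ^ (-γ) : ℝ) : ℂ) * F y) L x ∧
      ∀ v, L v = ∫ y, ((‖x - y‖ ^ (-γ) : ℝ) : ℂ) * fderiv ℝ F y v := by
  have e0 : (fun x => ∫ y, ((‖x - y‖ ^ (-γ) : ℝ) : ℂ) * F y) =
      fun x => ∫ z : EuclideanSpace ℝ (Fin d), (‖z‖ ^ (-γ)) • F (x - z) := by
    ext x
    rw [← integral_sub_left_eq_self _ volume x]
    simp
  let F' := SchwartzMap.fderivCLM ℝ (EuclideanSpace ℝ (Fin d)) ℂ F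
  obtain ⟨b, hb, h⟩ := schwartz_ker_bound hd hγ0 hγd F' x
  have hi := schwartz_ker_int hd hγ0 hγd F' x
  refine ⟨∫ z : EuclideanSpace ℝ (Fin d), (‖z‖ ^ (-γ)) • F' (x - z), ?_, ?_⟩
  · rw [e0]
    refine hasFDerivAt_integral_of_dominated_of_fderiv_le (bound := b)
      (F' := fun x z => (‖z‖ ^ (-γ)) • F' (x - z)) (Metric.ball_mem_nhds x one_pos)
      (Filter.Eventually.of_forall fun x => schwartz_ker_meas F x) (schwartz_ker_int hd hγ0 hγd F x)
      (schwartz_ker_meas F' x) (Filter.Eventually.of_forall fun z x hx => h x hx z) hb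
      (Filter.Eventually.of_forall fun z x hx => ?_)
    have := (F.differentiableAt (x := x - z)).hasFDerivAt.comp x ((hasFDerivAt_id x).sub_const z)
    have h2 : HasFDerivAt (fun x => F (x - z)) (F' (x - z)) x := by
      rw [ContinuousLinearMap.comp_id] at this
      exact this
    exact h2.const_smul (‖z‖ ^ (-γ))
  · intro v
    rw [ContinuousLinearMap.integral_apply hi, ← integral_sub_left_eq_self _ volume x]
    simp [F']

lemma Jfield_apply (d : ℕ) (t : ℝ) (u : EuclideanSpace ℝ (Fin d) → ℂ) (x : EuclideanSpace ℝ (Fin d)) (j : Fin d) :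
    Jfield d t u x j = (x j : ℂ) * u x + 2 * Complex.I * (t : ℂ) * fderiv ℝ u x (EuclideanSpace.single j 1) := rfl

lemma Jfield_cont (d : ℕ) (t : ℝ) (u : SchwartzMap (EuclideanSpace ℝ (Fin d)) ℂ) :
    Continuous (Jfield d t u) := by
  refine (PiLp.continuous_toLp 2 _).comp (continuous_pi fun j => ?_)
  have h1 : Continuous (fderiv ℝ u) := (u.smooth 1).continuous_fderiv (by simp)
  have h2 := u.continuous
  have h3 : Continuous fun x => fderiv ℝ u x (EuclideanSpace.single j 1) := h1.clm_apply continuous_const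
  fun_prop

lemma enorm_apply_le {d : ℕ} (v : EuclideanSpace ℂ (Fin d)) (j : Fin d) : ‖v j‖ₑ ≤ ‖v‖ₑ := by
  rw [enorm_le_iff_norm_le]; exact PiLp.norm_apply_le v j

lemma enorm_le_of_apply {d : ℕ} (v : EuclideanSpace ℂ (Fin d)) (B : ℝ≥0∞) (h : ∀ j, ‖v j‖ₑ ≤ B) :
    ‖v‖ₑ ≤ d * B := by
  have : v = ∑ j, EuclideanSpace.single j (v j) := by
    ext i; simp
  rw [this]
  refine (enorm_sum_le _ _).trans ?_
  refine (Finset.sum_le_sum (g := fun _ => B) fun j _ => ?_).trans (by simp)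
  refine le_trans (le_of_eq ?_) (h j)
  rw [← ofReal_norm, ← ofReal_norm]; simp

lemma J_pointwise (d : ℕ) (hd : 1 ≤ d) (γ : ℝ) (hγ0 : 0 < γ) (hγd : γ < d) (t : ℝ)
    (u₁ u₂ u₃ : SchwartzMap (EuclideanSpace ℝ (Fin d)) ℂ) (x : EuclideanSpace ℝ (Fin d)) :
    ‖Jfield d t (hartreeT d γ u₁ u₂ u₃) x‖ₑ ≤ d *
      ((∫⁻ y, ENNReal.ofReal (‖x - y‖ ^ (-γ)) * (‖Jfield d t u₁ y‖ₑ * ‖u₂ y‖ₑ)) * ‖u₃ x‖ₑ +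
       (∫⁻ y, ENNReal.ofReal (‖x - y‖ ^ (-γ)) * (‖u₁ y‖ₑ * ‖Jfield d t u₂ y‖ₑ)) * ‖u₃ x‖ₑ +
       (∫⁻ y, ENNReal.ofReal (‖x - y‖ ^ (-γ)) * (‖u₁ y‖ₑ * ‖u₂ y‖ₑ)) * ‖Jfield d t u₃ x‖ₑ) := by
  refine enorm_le_of_apply _ _ fun j => ?_
  let B : ℂ →L[ℝ] ℂ →L[ℝ] ℂ := ((ContinuousLinearMap.mul ℝ ℂ).flip.comp (Complex.conjCLE : ℂ →L[ℝ] ℂ)).flip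
  let F : SchwartzMap (EuclideanSpace ℝ (Fin d)) ℂ := SchwartzMap.pairing B u₁ u₂
  have hF : ∀ y, F y = u₁ y * (starRingEnd ℂ) (u₂ y) := fun y => by simp [F, B, mul_comm]
  set e : EuclideanSpace ℝ (Fin d) := EuclideanSpace.single j 1 with he
  have hF' : ∀ y, fderiv ℝ F y e = fderiv ℝ u₁ y e * (starRingEnd ℂ) (u₂ y) +
      u₁ y * (starRingEnd ℂ) (fderiv ℝ u₂ y e) := by
    intro y
    have h1 := (u₁.differentiableAt (x := y)).hasFDerivAt
    have h2 := (u₂.differentiableAt (x := y)).hasFDerivAt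
    have h3 : HasFDerivAt (fun y => (starRingEnd ℂ) (u₂ y)) ((Complex.conjCLE : ℂ →L[ℝ] ℂ).comp (fderiv ℝ u₂ y)) y :=
      (Complex.conjCLE : ℂ →L[ℝ] ℂ).hasFDerivAt.comp y h2
    have h4 := h1.mul h3
    have : (F : EuclideanSpace ℝ (Fin d) → ℂ) = fun y => u₁ y * (starRingEnd ℂ) (u₂ y) := funext hF
    rw [this]
    erw [h4.fderiv]
    simp; ring
  obtain ⟨L, hL, hLv⟩ := conv_deriv hd hγ0 hγd F x
  set Φ : EuclideanSpace ℝ (Fin d) → ℂ := fun x => ∫ y, ((‖x - y‖ ^ (-γ) : ℝ) : ℂ) * F y with hΦ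
  have hT : hartreeT d γ u₁ u₂ u₃ = fun x => Φ x * u₃ x := by
    ext x; simp only [hartreeT, hΦ, hF]
  have hd3 := hL.mul (u₃.differentiableAt (x := x)).hasFDerivAt
  have hTd : fderiv ℝ (hartreeT d γ u₁ u₂ u₃) x e = Φ x * fderiv ℝ u₃ x e + u₃ x * L e := by
    rw [hT]; erw [hd3.fderiv]; simp
  have hJ : Jfield d t (hartreeT d γ u₁ u₂ u₃) x j =
      (2 * Complex.I * t * L e) * u₃ x + Φ x * Jfield d t u₃ x j := by
    rw [Jfield_apply, Jfield_apply, hTd, hT]; ring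
  have hLe : 2 * Complex.I * t * L e = ∫ y, ((‖x - y‖ ^ (-γ) : ℝ) : ℂ) *
      (Jfield d t u₁ y j * (starRingEnd ℂ) (u₂ y) - u₁ y * (starRingEnd ℂ) (Jfield d t u₂ y j)) := by
    rw [hLv, ← integral_const_mul]
    congr 1; ext y
    rw [hF', Jfield_apply, Jfield_apply]
    simp only [map_add, map_mul, Complex.conj_I, Complex.conj_ofReal, map_ofNat]
    ring
  have hk : ∀ y, ‖((‖x - y‖ ^ (-γ) : ℝ) : ℂ)‖ₑ = ENNReal.ofReal (‖x - y‖ ^ (-γ)) := by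
    intro y
    rw [← ofReal_norm, Complex.norm_real, Real.norm_of_nonneg (by positivity)]
  have hc : ∀ z : ℂ, ‖(starRingEnd ℂ) z‖ₑ = ‖z‖ₑ := fun z => by
    rw [← ofReal_norm, ← ofReal_norm, Complex.norm_conj]
  have b1 : ‖2 * Complex.I * t * L e‖ₑ ≤
      (∫⁻ y, ENNReal.ofReal (‖x - y‖ ^ (-γ)) * (‖Jfield d t u₁ y‖ₑ * ‖u₂ y‖ₑ)) +
      (∫⁻ y, ENNReal.ofReal (‖x - y‖ ^ (-γ)) * (‖u₁ y‖ₑ * ‖Jfield d t u₂ y‖ₑ)) := by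
    rw [hLe]
    refine (enorm_integral_le_lintegral_enorm _).trans ?_
    have m1 := (Jfield_cont d t u₁).enorm.measurable
    have m2 := u₂.continuous.enorm.measurable
    rw [← lintegral_add_left (by fun_prop)]
    refine lintegral_mono fun y => ?_
    rw [enorm_mul, hk, ← mul_add]
    refine mul_le_mul_right ?_ _
    refine (enorm_sub_le).trans ?_
    rw [enorm_mul, enorm_mul, hc, hc]
    exact add_le_add (mul_le_mul_left (enorm_apply_le _ _) _) (mul_le_mul_right (enorm_apply_le _ _) _)
  have b2 : ‖Φ x‖ₑ ≤ ∫⁻ y, ENNReal.ofReal (‖x - y‖ ^ (-γ)) * (‖u₁ y‖ₑ * ‖u₂ y‖ₑ) := by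
    refine (enorm_integral_le_lintegral_enorm _).trans (le_of_eq ?_)
    congr 1; ext y
    rw [enorm_mul, hk, hF, enorm_mul, hc]
  rw [hJ, ← add_mul]
  refine (enorm_add_le _ _).trans ?_
  rw [enorm_mul (2 * Complex.I * t * L e), enorm_mul (Φ x)]
  exact add_le_add (mul_le_mul_left b1 _) (mul_le_mul' b2 (enorm_apply_le _ _))


/-- **`J(t)` estimate for the trilinear Hartree form.** For `d ≥ 1`, `0 < γ < d`,
`r = 4d/(2d-γ)` and `r'` its Hölder conjugate, there is `C = C(d,γ) > 0` such that for all
`t ∈ ℝ` and Schwartz `u₁,u₂,u₃`,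
`‖J(t)T(u₁,u₂,u₃)‖_{L^{r'}} ≤ C ∑_{i} ‖J(t)u_i‖_{L^r} ∏_{j≠i} ‖u_j‖_{L^r}`. -/
theorem hartreeT_J_estimate (d : ℕ) (hd : 1 ≤ d) (γ : ℝ) (hγ0 : 0 < γ)
    (hγd : γ < d) (r' : ℝ) (hconj : 1 / (4 * d / (2 * d - γ)) + 1 / r' = 1) :
    ∃ C > (0 : ℝ), ∀ (t : ℝ) (u₁ u₂ u₃ : SchwartzMap (EuclideanSpace ℝ (Fin d)) ℂ),
      eLpNorm (Jfield d t (hartreeT d γ ⇑u₁ ⇑u₂ ⇑u₃)) (ENNReal.ofReal r') volume ≤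
        ENNReal.ofReal C *
          (eLpNorm (Jfield d t ⇑u₁) (ENNReal.ofReal (4 * d / (2 * d - γ))) volume *
              eLpNorm (⇑u₂) (ENNReal.ofReal (4 * d / (2 * d - γ))) volume *
              eLpNorm (⇑u₃) (ENNReal.ofReal (4 * d / (2 * d - γ))) volume +
            eLpNorm (⇑u₁) (ENNReal.ofReal (4 * d / (2 * d - γ))) volume *
              eLpNorm (Jfield d t ⇑u₂) (ENNReal.ofReal (4 * d / (2 * d - γ))) volume *
              eLpNorm (⇑u₃) (ENNReal.ofReal (4 * d / (2 * d - γ))) volume +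
            eLpNorm (⇑u₁) (ENNReal.ofReal (4 * d / (2 * d - γ))) volume *
              eLpNorm (⇑u₂) (ENNReal.ofReal (4 * d / (2 * d - γ))) volume *
              eLpNorm (Jfield d t ⇑u₃) (ENNReal.ofReal (4 * d / (2 * d - γ))) volume) := by

  have hd0 : (0 : ℝ) < d := by exact_mod_cast hd
  have h2 : (0 : ℝ) < 2 * d - γ := by linarith
  have hr' : r' = 4 * d / (2 * d + γ) := by
    have h1 : 1 / r' = (2 * d + γ) / (4 * d) := by
      have : 1 / r' = 1 - 1 / (4 * d / (2 * d - γ)) := by linarith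
      rw [this]; field_simp; ring
    rw [← one_div_one_div r', h1, one_div_div]
  set r : ℝ := 4 * d / (2 * d - γ) with hr
  have hr0 : 0 < r := by positivity
  have hr'1 : 1 ≤ r' := by rw [hr', le_div_iff₀ (by linarith)]; linarith
  have hr'0 : 0 < r' := by linarith
  obtain ⟨C, hC, hC0, h⟩ := hls_tri d hd γ hγ0 hγd r r' hr hr'
  have hDt : (d : ℝ≥0∞) * C ≠ ∞ := ENNReal.mul_ne_top (by simp) hC
  have hD0 : (d : ℝ≥0∞) * C ≠ 0 := mul_ne_zero (by exact_mod_cast (by omega : d ≠ 0)) hC0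
  refine ⟨((d : ℝ≥0∞) * C).toReal, ENNReal.toReal_pos hD0 hDt, ?_⟩
  intro t u₁ u₂ u₃
  rw [ENNReal.ofReal_toReal hDt]
  have en : ∀ {V : Type} [NormedAddCommGroup V] (f : EuclideanSpace ℝ (Fin d) → V) (s : ℝ), 0 < s →
      eLpNorm f (ENNReal.ofReal s) volume = (∫⁻ x, ‖f x‖ₑ ^ s) ^ (1 / s) := by
    intro V _ f s hs
    rw [eLpNorm_eq_lintegral_rpow_enorm_toReal (by simpa using hs) (by simp), ENNReal.toReal_ofReal hs.le]
  simp only [en _ _ hr0, en _ _ hr'0]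
  have m1 := u₁.continuous.enorm.measurable
  have m2 := u₂.continuous.enorm.measurable
  have m3 := u₃.continuous.enorm.measurable
  have n1 := (Jfield_cont d t u₁).enorm.measurable
  have n2 := (Jfield_cont d t u₂).enorm.measurable
  have n3 := (Jfield_cont d t u₃).enorm.measurable
  have mG : ∀ a b : EuclideanSpace ℝ (Fin d) → ℝ≥0∞, Measurable a → Measurable b →
      Measurable fun x => ∫⁻ y, ENNReal.ofReal (‖x - y‖ ^ (-γ)) * (a y * b y) := by
    intro a b ha hb
    refine Measurable.lintegral_prod_right' (f := fun z : EuclideanSpace ℝ (Fin d) × EuclideanSpace ℝ (Fin d) =>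
      ENNReal.ofReal (‖z.1 - z.2‖ ^ (-γ)) * (a z.2 * b z.2)) ?_
    fun_prop
  let S1 := fun x => (∫⁻ y, ENNReal.ofReal (‖x - y‖ ^ (-γ)) * (‖Jfield d t u₁ y‖ₑ * ‖u₂ y‖ₑ)) * ‖u₃ x‖ₑ
  let S2 := fun x => (∫⁻ y, ENNReal.ofReal (‖x - y‖ ^ (-γ)) * (‖u₁ y‖ₑ * ‖Jfield d t u₂ y‖ₑ)) * ‖u₃ x‖ₑ
  let S3 := fun x => (∫⁻ y, ENNReal.ofReal (‖x - y‖ ^ (-γ)) * (‖u₁ y‖ₑ * ‖u₂ y‖ₑ)) * ‖Jfield d t u₃ x‖ₑ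
  have s1 : Measurable S1 := (mG _ _ n1 m2).mul m3
  have s2 : Measurable S2 := (mG _ _ m1 n2).mul m3
  have s3 : Measurable S3 := (mG _ _ m1 m2).mul n3
  calc (∫⁻ x, ‖Jfield d t (hartreeT d γ u₁ u₂ u₃) x‖ₑ ^ r') ^ (1 / r')
      ≤ (∫⁻ x, ((d : ℝ≥0∞) * (S1 + S2 + S3) x) ^ r') ^ (1 / r') := by
        refine ENNReal.rpow_le_rpow (lintegral_mono fun x => ?_) (by positivity)
        exact ENNReal.rpow_le_rpow (J_pointwise d hd γ hγ0 hγd t u₁ u₂ u₃ x) hr'0.le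
    _ = (d : ℝ≥0∞) * (∫⁻ x, ((S1 + S2 + S3) x) ^ r') ^ (1 / r') := by
        simp_rw [ENNReal.mul_rpow_of_nonneg _ _ hr'0.le]
        rw [lintegral_const_mul _ (((s1.add s2).add s3).pow_const _), ENNReal.mul_rpow_of_nonneg _ _ (by positivity),
          ← ENNReal.rpow_mul, mul_one_div_cancel hr'0.ne', ENNReal.rpow_one]
    _ ≤ (d : ℝ≥0∞) * ((∫⁻ x, S1 x ^ r') ^ (1 / r') + (∫⁻ x, S2 x ^ r') ^ (1 / r') + (∫⁻ x, S3 x ^ r') ^ (1 / r')) := by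
        refine mul_le_mul_right ?_ _
        refine (ENNReal.lintegral_Lp_add_le (s1.add s2).aemeasurable s3.aemeasurable hr'1).trans ?_
        exact add_le_add_left (ENNReal.lintegral_Lp_add_le s1.aemeasurable s2.aemeasurable hr'1) _
    _ ≤ (d : ℝ≥0∞) * (C * _ + C * _ + C * _) :=
        mul_le_mul_right (add_le_add (add_le_add (h _ _ _ n1 m2 m3) (h _ _ _ m1 n2 m3)) (h _ _ _ m1 m2 n3)) _
    _ = _ := by ring
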